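/- arXiv:1503.08368 — 2 statements merged into one kernel-verified Lean document; each statement's English description precedes it below -/
import Mathlib

section
/- For all integers n ≥ 2 and 1 ≤ m ≤ n−1, the characteristic polynomial of the top-m-to-random transition matrix P_m on S_n (a matrix over ℚ indexed by S_n) equals ∏_{σ ∈ S_n} (X − b_m(σ)/C(n,m)), where b_m(σ) is the number of sub-multisets (counted with multiplicity) of the multiset of cycle lengths of σ (each fixed point counted as a cycle of length 1) whose elements sum to m. Equivalently, for each partition λ of n, the eigenvalue ⟨λ,(m,n−m)⟩/C(n,m) occurs with multiplicity equal to the number of permutations of cycle type λ, where ⟨λ,(m,n−m)⟩ is the number of ways to split the parts of λ into two blocks with sums m and n−m. -/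
open Finset
open scoped Classical

/-- `w ∈ W_m` iff `w⁻¹` is increasing on the first `m` values and on the last `n-m`
values (0-indexed: `w⁻¹(0) < … < w⁻¹(m-1)` and `w⁻¹(m) < … < w⁻¹(n-1)`). -/
def topMW (n m : ℕ) (w : Equiv.Perm (Fin n)) : Prop :=
  (∀ i j : Fin n, i < j → (j : ℕ) < m → w⁻¹ i < w⁻¹ j) ∧
  (∀ i j : Fin n, i < j → m ≤ (i : ℕ) → w⁻¹ i < w⁻¹ j)

/-- top-`m`-to-random transition matrix: cut off the top `m` cards and riffle them
uniformly into the remaining `n-m`, preserving relative order. -/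
noncomputable def Pm (n m : ℕ) : Matrix (Equiv.Perm (Fin n)) (Equiv.Perm (Fin n)) ℚ :=
  fun σ τ => if topMW n m (σ⁻¹ * τ) then 1 / (n.choose m : ℚ) else 0

/-- multiset of cycle lengths of `σ`, including each fixed point as a `1` -/
def fullCycleType (n : ℕ) (σ : Equiv.Perm (Fin n)) : Multiset ℕ :=
  σ.cycleType + Multiset.replicate (n - σ.support.card) 1

/-- number of sub-multisets of the multiset of cycle lengths of `σ` summing to `m`,
counted with multiplicity -/
def bm (n m : ℕ) (σ : Equiv.Perm (Fin n)) : ℕ :=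
  (((fullCycleType n σ).powerset).filter (fun t => t.sum = m)).card

section helpers

variable {n : ℕ}

def SrtBy {L : Type} [LinearOrder L] (f : Fin n → L) (w : Equiv.Perm (Fin n)) : Prop :=
  ∀ p q, w p < w q ↔ (f p < f q ∨ (f p = f q ∧ p < q))

theorem perm_eq_one_of_mono (u : Equiv.Perm (Fin n)) (h : ∀ p q, u p < u q ↔ p < q) : u = 1 := by
  have hm : StrictMono u := fun p q hpq => (h p q).2 hpq
  have : Monotone (id ∘ u) := hm.monotone
  let e : Fin n ≃o Fin n := ⟨u, by intro a b; exact hm.le_iff_le⟩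
  have he : e = OrderIso.refl _ := Subsingleton.elim _ _
  ext p
  have := congrArg (fun e : Fin n ≃o Fin n => (e p : ℕ)) he
  simpa [e] using this

theorem SrtBy.unique {L : Type} [LinearOrder L] {f : Fin n → L} {w w' : Equiv.Perm (Fin n)}
    (h : SrtBy f w) (h' : SrtBy f w') : w = w' := by
  have : w * w'⁻¹ = 1 := by
    apply perm_eq_one_of_mono
    intro p q
    have h1 := h (w'⁻¹ p) (w'⁻¹ q)
    have h2 := h' (w'⁻¹ p) (w'⁻¹ q)
    rw [show w' (w'⁻¹ p) = p by simp, show w' (w'⁻¹ q) = q by simp] at h2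
    simp only [Equiv.Perm.mul_apply]
    rw [h1, h2]
  exact mul_inv_eq_one.1 this

theorem sort_lt {L : Type} [LinearOrder L] (f : Fin n → L) (i j : Fin n) :
    i < j ↔ (f (Tuple.sort f i) < f (Tuple.sort f j) ∨
      (f (Tuple.sort f i) = f (Tuple.sort f j) ∧ Tuple.sort f i < Tuple.sort f j)) := by
  have key := (Tuple.eq_sort_iff (f := f) (σ := Tuple.sort f)).1 rfl
  have fwd : ∀ i j : Fin n, i < j → (f (Tuple.sort f i) < f (Tuple.sort f j) ∨
      (f (Tuple.sort f i) = f (Tuple.sort f j) ∧ Tuple.sort f i < Tuple.sort f j)) := by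
    intro i j hij
    rcases (key.1 hij.le).lt_or_eq with h | h
    · exact Or.inl h
    · exact Or.inr ⟨h, key.2 i j hij h⟩
  constructor
  · exact fwd i j
  · intro h
    by_contra hn
    rcases (not_lt.1 hn).lt_or_eq with h2 | h2
    · have := fwd j i h2
      rcases h with h | ⟨h, h'⟩ <;> rcases this with t | ⟨t, t'⟩
      · exact lt_asymm h t
      · exact h.ne' t
      · exact t.ne' h
      · exact lt_asymm h' t'
    · subst h2; simp at h

theorem srtBy_iff {L : Type} [LinearOrder L] (f : Fin n → L) (w : Equiv.Perm (Fin n)) :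
    SrtBy f w ↔ w = (Tuple.sort f)⁻¹ := by
  have h0 : SrtBy f (Tuple.sort f)⁻¹ := by
    intro p q
    rw [sort_lt f]
    simp
  constructor
  · intro h; exact h.unique h0
  · rintro rfl; exact h0

theorem srtBy_one {L : Type} [LinearOrder L] (f : Fin n → L) :
    SrtBy f 1 ↔ Monotone f := by
  rw [srtBy_iff, eq_comm, inv_eq_one, Tuple.sort_eq_refl_iff_monotone.symm]
  rfl

theorem srtBy_prod {L L' : Type} [LinearOrder L] [LinearOrder L'] (f : Fin n → L) (g : Fin n → L')
    (u : Equiv.Perm (Fin n)) :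
    SrtBy (fun p => toLex (f p, g p)) u ↔ SrtBy (f ∘ Tuple.sort g) (u * Tuple.sort g) := by
  unfold SrtBy
  have : ∀ P : Fin n → Fin n → Prop, (∀ p q, P p q) ↔
    ∀ p q, P (Tuple.sort g p) (Tuple.sort g q) := by
    intro P
    constructor
    · intro h p q; exact h _ _
    · intro h p q; simpa using h ((Tuple.sort g)⁻¹ p) ((Tuple.sort g)⁻¹ q)
  rw [this]
  refine forall_congr' fun p => forall_congr' fun q => ?_
  simp only [Equiv.Perm.mul_apply, Function.comp, sort_lt g p q, Prod.Lex.lt_iff, ofLex_toLex,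
    EmbeddingLike.apply_eq_iff_eq, Prod.mk.injEq]
  tauto

/-- number-of-sorting-words matrix -/
noncomputable def srtMat {L : Type} [LinearOrder L] (F : Finset (Fin n → L)) :
    Matrix (Equiv.Perm (Fin n)) (Equiv.Perm (Fin n)) ℚ :=
  fun σ τ => ((F.filter (fun f => SrtBy f (σ⁻¹ * τ))).card : ℚ)

def PInv {L : Type} (F : Finset (Fin n → L)) : Prop :=
  ∀ f ∈ F, ∀ s : Equiv.Perm (Fin n), f ∘ s ∈ F

noncomputable def pairSet {L L' : Type} (F : Finset (Fin n → L)) (G : Finset (Fin n → L')) :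
    Finset (Fin n → L ×ₗ L') :=
  (F ×ˢ G).image (fun x p => toLex (x.1 p, x.2 p))

theorem pairSet_inj {L L' : Type} : Function.Injective
    (fun (x : (Fin n → L) × (Fin n → L')) (p : Fin n) => toLex (x.1 p, x.2 p)) := by
  rintro ⟨f, g⟩ ⟨f', g'⟩ h
  have h' := fun p => congrFun h p
  simp only [toLex_inj, Prod.mk.injEq] at h'
  exact Prod.ext (funext fun p => (h' p).1) (funext fun p => (h' p).2)

theorem card_pairSet_filter {L L' : Type} (F : Finset (Fin n → L)) (G : Finset (Fin n → L'))
    (Q : (Fin n → L ×ₗ L') → Prop) :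
    ((pairSet F G).filter Q).card =
      ∑ g ∈ G, (F.filter (fun f => Q (fun p => toLex (f p, g p)))).card := by
  unfold pairSet
  rw [Finset.filter_image, Finset.card_image_of_injective _ pairSet_inj, Finset.card_filter,
    Finset.sum_product_right]
  simp only [Finset.card_filter]

theorem pinv_pair {L L' : Type} {F : Finset (Fin n → L)} {G : Finset (Fin n → L')}
    (hF : PInv F) (hG : PInv G) : PInv (pairSet F G) := by
  intro h hh s
  simp only [pairSet, Finset.mem_image, Finset.mem_product, Prod.exists] at hh ⊢
  obtain ⟨f, g, ⟨hf, hg⟩, rfl⟩ := hh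
  exact ⟨f ∘ s, g ∘ s, ⟨hF f hf s, hG g hg s⟩, rfl⟩

theorem card_filter_comp {L : Type} {F : Finset (Fin n → L)} (hF : PInv F)
    (s : Equiv.Perm (Fin n)) (Q : (Fin n → L) → Prop) :
    (F.filter (fun f => Q (f ∘ s))).card = (F.filter Q).card := by
  apply Finset.card_bij' (fun f _ => f ∘ s) (fun f _ => f ∘ (s⁻¹ : Equiv.Perm (Fin n)))
  · intro f hf
    simp only [Finset.mem_filter] at hf ⊢
    exact ⟨hF f hf.1 s, hf.2⟩
  · intro f hf
    simp only [Finset.mem_filter] at hf ⊢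
    refine ⟨hF f hf.1 _, ?_⟩
    convert hf.2
    ext p; simp
  · intro f hf; ext p; simp
  · intro f hf; ext p; simp

theorem srtMat_mul {L L' : Type} [LinearOrder L] [LinearOrder L'] {F : Finset (Fin n → L)}
    (hF : PInv F) (G : Finset (Fin n → L')) :
    srtMat F * srtMat G = srtMat (pairSet F G) := by
  ext σ τ
  simp only [Matrix.mul_apply, srtMat]
  rw [card_pairSet_filter]
  have h1 : ∀ ρ : Equiv.Perm (Fin n),
      ((F.filter (fun f => SrtBy f (σ⁻¹ * ρ))).card : ℚ) *
        ((G.filter (fun g => SrtBy g (ρ⁻¹ * τ))).card : ℚ) =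
      ∑ g ∈ G, if ρ = τ * Tuple.sort g then
        ((F.filter (fun f => SrtBy f (σ⁻¹ * ρ))).card : ℚ) else 0 := by
    intro ρ
    rw [Finset.card_filter _ G]
    push_cast
    rw [Finset.mul_sum]
    refine Finset.sum_congr rfl fun g _ => ?_
    have : SrtBy g (ρ⁻¹ * τ) ↔ ρ = τ * Tuple.sort g := by
      rw [srtBy_iff, eq_inv_iff_mul_eq_one, mul_assoc, inv_mul_eq_one]
    simp only [this]
    split_ifs <;> simp
  simp only [h1]
  rw [Finset.sum_comm]
  push_cast
  refine Finset.sum_congr rfl fun g _ => ?_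
  rw [Finset.sum_ite_eq' Finset.univ (τ * Tuple.sort g)]
  simp only [Finset.mem_univ, if_true, srtBy_prod]
  rw [← card_filter_comp hF (Tuple.sort g)]
  simp only [mul_assoc]

def IsFx {L : Type} (σ : Equiv.Perm (Fin n)) (h : Fin n → L) : Prop := h ∘ σ = h

noncomputable def fixN {L : Type} (F : Finset (Fin n → L)) (σ : Equiv.Perm (Fin n)) : ℕ :=
  (F.filter (IsFx σ)).card

theorem fix_pair {L L' : Type} (F : Finset (Fin n → L)) (G : Finset (Fin n → L'))
    (σ : Equiv.Perm (Fin n)) :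
    fixN (pairSet F G) σ =
      fixN F σ * fixN G σ := by
  unfold fixN
  rw [card_pairSet_filter, Finset.card_filter _ G, Finset.mul_sum]
  refine Finset.sum_congr rfl fun g _ => ?_
  have : ∀ f : Fin n → L, IsFx σ (fun p => toLex (f p, g p)) ↔
      (IsFx σ f ∧ IsFx σ g) := by
    intro f
    simp only [IsFx, funext_iff, Function.comp, toLex_inj, Prod.mk.injEq, forall_and]
  simp only [this]
  by_cases hg : IsFx σ g <;> simp [hg]

theorem burnside {L : Type} [LinearOrder L] {F : Finset (Fin n → L)} (hF : PInv F) :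
    ∑ σ : Equiv.Perm (Fin n), fixN F σ =
      ∑ _σ : Equiv.Perm (Fin n), (F.filter (fun h => Monotone h)).card := by
  have h1 : ∑ σ : Equiv.Perm (Fin n), fixN F σ =
      ∑ σ : Equiv.Perm (Fin n), (F.filter (fun h => (h ∘ Tuple.sort h) ∘ σ = h)).card := by
    simp only [fixN, Finset.card_filter, IsFx]
    rw [Finset.sum_comm, Finset.sum_comm (s := Finset.univ)]
    refine Finset.sum_congr rfl fun f _ => ?_
    apply Finset.sum_equiv (Equiv.mulLeft (Tuple.sort f)⁻¹)
    · simp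
    · intro σ _
      have : (f ∘ Tuple.sort f) ∘ (Equiv.mulLeft (Tuple.sort f)⁻¹ σ) = f ∘ σ := by
        ext p; simp
      rw [this]
      congr
  rw [h1]
  refine Finset.sum_congr rfl fun σ _ => ?_
  apply Finset.card_bij' (fun f _ => f ∘ Tuple.sort f) (fun g _ => g ∘ σ)
  case hi =>
    intro f hf
    simp only [Finset.mem_filter] at hf ⊢
    exact ⟨hF f hf.1 _, Tuple.monotone_sort f⟩
  case hj =>
    intro g hg
    simp only [Finset.mem_filter] at hg ⊢
    refine ⟨hF g hg.1 _, ?_⟩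
    rw [Tuple.comp_perm_comp_sort_eq_comp_sort, ← (Tuple.comp_sort_eq_comp_iff_monotone (σ := 1)).2]
    · rfl
    · exact hg.2
  case left_inv =>
    intro f hf
    simp only [Finset.mem_filter] at hf
    exact hf.2
  case right_inv =>
    intro g hg
    simp only [Finset.mem_filter] at hg
    rw [Tuple.comp_perm_comp_sort_eq_comp_sort, ← (Tuple.comp_sort_eq_comp_iff_monotone (σ := 1)).2]
    · rfl
    · exact hg.2

theorem trace_srtMat {L : Type} [LinearOrder L] {F : Finset (Fin n → L)} (hF : PInv F) :
    (srtMat F).trace = ∑ σ : Equiv.Perm (Fin n), (fixN F σ : ℚ) := by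
  have := burnside hF
  rw [← Nat.cast_sum, this]
  simp [Matrix.trace, srtMat, srtBy_one]

theorem pow_srtMat {L : Type} [LinearOrder L] {F : Finset (Fin n → L)} (hF : PInv F) (k : ℕ) :
    ∃ (K : Type) (_ : LinearOrder K) (G : Finset (Fin n → K)), PInv G ∧ srtMat F ^ k = srtMat G ∧
      ∀ σ : Equiv.Perm (Fin n), fixN G σ =
        fixN F σ ^ k := by
  induction k with
  | zero =>
    refine ⟨Unit, inferInstance, {fun _ => ()}, ?_, ?_, ?_⟩
    · intro f _ s; simp
    · ext σ τ
      have : ∀ f : Fin n → Unit, SrtBy f (σ⁻¹ * τ) ↔ σ = τ := by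
        intro f
        have h1 : SrtBy f 1 := by intro p q; simp
        constructor
        · intro h; exact inv_mul_eq_one.1 (h.unique h1)
        · rintro rfl; simpa using h1
      simp only [pow_zero, Matrix.one_apply, srtMat, this]
      by_cases h : σ = τ <;> simp [h]
    · intro σ
      rw [fixN, Finset.filter_true_of_mem]
      · simp
      · intro f _; rfl
  | succ k ih =>
    obtain ⟨K, _, G, hG, hP, hc⟩ := ih
    refine ⟨K ×ₗ L, inferInstance, pairSet G F, pinv_pair hG hF, ?_, ?_⟩
    · rw [pow_succ, hP, srtMat_mul hG]
    · intro σ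
      rw [fix_pair, hc, pow_succ]

theorem trace_pow_srtMat {L : Type} [LinearOrder L] {F : Finset (Fin n → L)} (hF : PInv F) (k : ℕ) :
    (srtMat F ^ k).trace =
      ∑ σ : Equiv.Perm (Fin n), (fixN F σ : ℚ) ^ k := by
  obtain ⟨K, _, G, hG, hP, hc⟩ := pow_srtMat hF k
  rw [hP, trace_srtMat hG]
  simp [hc]

theorem det_aeval_eq {ι K : Type} [Fintype ι] [DecidableEq ι] [Field K] [IsAlgClosed K]
    (A : Matrix ι ι K) (q : Polynomial K) :
    (Polynomial.aeval A q).det = (A.charpoly.roots.map (fun r => q.eval r)).prod := by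
  have hcard : A.charpoly.roots.card = Fintype.card ι := by
    rw [← (IsAlgClosed.splits A.charpoly).natDegree_eq_card_roots, Matrix.charpoly_natDegree_eq_dim]
  have hlin : ∀ a : K, (A - algebraMap K _ a).det = (A.charpoly.roots.map (fun r => r - a)).prod := by
    intro a
    have h1 : A.charpoly.eval a = (A.charpoly.roots.map (fun r => a - r)).prod := by
      conv_lhs => rw [(IsAlgClosed.splits A.charpoly).eq_prod_roots_of_monic A.charpoly_monic]
      rw [Polynomial.eval_multiset_prod, Multiset.map_map]
      simp
    have h2 : A - algebraMap K _ a = -(Matrix.scalar ι a - A) := by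
      rw [neg_sub]; rfl
    rw [h2, Matrix.det_neg, ← Matrix.eval_charpoly, h1, ← hcard]
    have h3 : (fun r : K => r - a) = fun r => (-1) * (a - r) := by ext; ring
    rw [h3, Multiset.prod_map_mul]
    simp
  have hsp := (IsAlgClosed.splits q).eq_prod_roots
  have : ∀ s : Multiset K, (Polynomial.aeval A (s.map (fun a => Polynomial.X - Polynomial.C a)).prod).det =
      (A.charpoly.roots.map (fun r =>
        ((s.map (fun a => Polynomial.X - Polynomial.C a)).prod).eval r)).prod := by
    intro s
    induction s using Multiset.induction_on with
    | empty => simp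
    | cons a s ih =>
      simp only [Multiset.map_cons, Multiset.prod_cons, map_mul, Matrix.det_mul, ih,
        Polynomial.eval_mul, Multiset.prod_map_mul]
      simp [hlin]
  rw [hsp, map_mul, Matrix.det_mul, this]
  simp only [Polynomial.eval_mul, Multiset.prod_map_mul, Polynomial.eval_C, Polynomial.aeval_C,
    Multiset.map_const', Multiset.prod_replicate, hcard]
  congr 1
  rw [Algebra.algebraMap_eq_smul_one, Matrix.det_smul]
  simp

theorem trace_pow_eq_roots {ι K : Type} [Fintype ι] [DecidableEq ι] [Field K] [IsAlgClosed K]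
    (A : Matrix ι ι K) (k : ℕ) :
    (A ^ k).trace = (A.charpoly.roots.map (fun r => r ^ k)).sum := by
  have h : (A ^ k).charpoly =
      ((A.charpoly.roots.map (fun r => r ^ k)).map (fun a => Polynomial.X - Polynomial.C a)).prod := by
    apply Polynomial.funext
    intro x
    have h1 := det_aeval_eq A (Polynomial.C x - Polynomial.X ^ k)
    rw [Matrix.eval_charpoly, Polynomial.eval_multiset_prod]
    simp only [Multiset.map_map]
    simp only [map_sub, Polynomial.aeval_C, map_pow, Polynomial.aeval_X] at h1
    rw [show Matrix.scalar ι x = algebraMap K (Matrix ι ι K) x from rfl, h1]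
    simp
  rw [Matrix.trace_eq_sum_roots_charpoly, h, Polynomial.roots_multiset_prod_X_sub_C]

theorem multiset_eq_of_psum {K : Type} [Field K] [CharZero K] (s t : Multiset K)
    (h : ∀ k : ℕ, (s.map (fun r => r ^ k)).sum = (t.map (fun r => r ^ k)).sum) : s = t := by
  have hp : ∀ q : Polynomial K, (s.map (fun r => q.eval r)).sum = (t.map (fun r => q.eval r)).sum := by
    intro q
    induction q using Polynomial.induction_on' with
    | add p q hp hq => simp [Multiset.sum_map_add, hp, hq]
    | monomial k a => simp [Multiset.sum_map_mul_left, h]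
  ext a
  let S : Finset K := (s + t).toFinset.erase a
  let q : Polynomial K := ∏ b ∈ S, (Polynomial.X - Polynomial.C b)
  have hqa : q.eval a ≠ 0 := by
    simp only [q, Polynomial.eval_prod, Finset.prod_ne_zero_iff]
    intro b hb
    simp only [S, Finset.mem_erase] at hb
    simpa [sub_eq_zero] using hb.1.symm
  have key : ∀ u : Multiset K, (∀ x ∈ u, x ∈ s + t) →
      (u.map (fun r => q.eval r)).sum = (u.count a : K) * q.eval a := by
    intro u
    induction u using Multiset.induction_on with
    | empty => simp
    | cons b u ih =>
      intro hu
      rw [Multiset.map_cons, Multiset.sum_cons, ih (fun x hx => hu x (Multiset.mem_cons_of_mem hx))]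
      by_cases hb : b = a
      · subst hb; simp; ring
      · have : q.eval b = 0 := by
          simp only [q, Polynomial.eval_prod]
          apply Finset.prod_eq_zero (i := b)
          · simp only [S, Finset.mem_erase, Multiset.mem_toFinset]
            exact ⟨hb, hu b (Multiset.mem_cons_self b u)⟩
          · simp
        rw [this, Multiset.count_cons_of_ne (Ne.symm hb)]; simp
  have h1 := key s (fun x hx => Multiset.mem_add.2 (Or.inl hx))
  have h2 := key t (fun x hx => Multiset.mem_add.2 (Or.inr hx))
  rw [hp q, h2] at h1
  exact_mod_cast (mul_right_cancel₀ hqa h1).symm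

theorem charpoly_of_traces {ι : Type} [Fintype ι] [DecidableEq ι] (A : Matrix ι ι ℚ) (d : ι → ℚ)
    (h : ∀ k : ℕ, (A ^ k).trace = ∑ i, d i ^ k) :
    A.charpoly = ∏ i, (Polynomial.X - Polynomial.C (d i)) := by
  let φ := algebraMap ℚ (AlgebraicClosure ℚ)
  apply Polynomial.map_injective φ φ.injective
  rw [← Matrix.charpoly_map, Polynomial.map_prod]
  have hr : (A.map φ).charpoly.roots = Finset.univ.val.map (fun i => φ (d i)) := by
    apply multiset_eq_of_psum
    intro k
    rw [← trace_pow_eq_roots, Multiset.map_map]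
    have : (A.map φ) ^ k = (A ^ k).map φ := by
      have := (map_pow φ.mapMatrix A k).symm
      simpa using this
    rw [this]
    have h2 := congrArg φ (h k)
    rw [map_sum] at h2
    have h3 : ((A ^ k).map φ).trace = φ (A ^ k).trace := by
      simp [Matrix.trace, map_sum]
    rw [h3, h2]
    simp
  rw [(IsAlgClosed.splits (A.map φ).charpoly).eq_prod_roots_of_monic (Matrix.charpoly_monic _), hr]
  simp [Multiset.map_map, Function.comp_def]

noncomputable def baseF (n m : ℕ) : Finset (Fin n → Bool) :=
  Finset.univ.filter (fun f => (Finset.univ.filter (fun p => f p = false)).card = m)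

theorem pinv_baseF (m : ℕ) : PInv (baseF n m) := by
  intro f hf s
  simp only [baseF, Finset.mem_filter, Finset.mem_univ, true_and] at hf ⊢
  rw [← hf]
  apply Finset.card_equiv s
  intro i
  simp

theorem lower_eq (S : Finset (Fin n)) (hS : ∀ i j, i < j → j ∈ S → i ∈ S) (i : Fin n) :
    i ∈ S ↔ (i : ℕ) < S.card := by
  constructor
  · intro hi
    have : Finset.Iic i ⊆ S := by
      intro j hj
      rcases (Finset.mem_Iic.1 hj).lt_or_eq with h | h
      · exact hS j i h hi
      · exact h ▸ hi
    have := Finset.card_le_card this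
    rw [Fin.card_Iic] at this
    omega
  · intro h
    by_contra hi
    have : S ⊆ Finset.Iio i := by
      intro j hj
      rw [Finset.mem_Iio]
      by_contra hji
      rcases (not_lt.1 hji).lt_or_eq with h | h
      · exact hi (hS i j h hj)
      · exact hi (h ▸ hj)
    have := Finset.card_le_card this
    rw [Fin.card_Iio] at this
    omega

def labF (m : ℕ) (w : Equiv.Perm (Fin n)) : Fin n → Bool := fun p => decide (m ≤ (w p : ℕ))

theorem labF_unique {m : ℕ} {f : Fin n → Bool} {w : Equiv.Perm (Fin n)} (hf : f ∈ baseF n m)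
    (h : SrtBy f w) : f = labF m w := by
  simp only [baseF, Finset.mem_filter, Finset.mem_univ, true_and] at hf
  let S : Finset (Fin n) := (Finset.univ.filter (fun p => f p = false)).map w.toEmbedding
  have hc : S.card = m := by rw [← hf]; exact Finset.card_map _
  have hmem : ∀ p, w p ∈ S ↔ f p = false := by
    intro p; simp [S]
  have hl := lower_eq S (by
    intro i j hij hj
    obtain ⟨p, rfl⟩ := w.surjective i
    obtain ⟨q, rfl⟩ := w.surjective j
    rw [hmem] at hj ⊢
    rcases (h p q).1 hij with h' | h'
    · rw [hj] at h'; exact absurd h' (by cases f p <;> decide)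
    · rw [h'.1, hj])
  ext p
  have h1 := hl (w p)
  rw [hmem, hc] at h1
  unfold labF
  by_cases hm : m ≤ (w p : ℕ)
  · have : ¬ (f p = false) := by rw [h1]; omega
    simpa [hm] using this
  · have : f p = false := by rw [h1]; omega
    simpa [hm] using this

theorem labF_mem {m : ℕ} (hm : m ≤ n) (w : Equiv.Perm (Fin n)) : labF m w ∈ baseF n m := by
  simp only [baseF, Finset.mem_filter, Finset.mem_univ, true_and, labF, decide_eq_false_iff_not,
    not_le]
  rw [Finset.card_equiv w (t := Finset.univ.filter (fun i : Fin n => (i : ℕ) < m))]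
  · have h := @Fin.card_filter_val_lt n m
    rw [Nat.min_eq_right hm] at h
    convert h
  · simp

theorem labF_srt (m : ℕ) (w : Equiv.Perm (Fin n)) : SrtBy (labF m w) w ↔ topMW n m w := by
  have lt_iff : ∀ p q, labF m w p < labF m w q ↔ ((w p : ℕ) < m ∧ m ≤ (w q : ℕ)) := by
    intro p q
    simp [labF, Bool.lt_iff]
  have eq_iff : ∀ p q, labF m w p = labF m w q ↔ (m ≤ (w p : ℕ) ↔ m ≤ (w q : ℕ)) := by
    intro p q
    simp [labF]
  unfold SrtBy topMW
  simp only [lt_iff, eq_iff]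
  constructor
  · intro h
    constructor
    · intro i j hij hj
      have := (h (w⁻¹ i) (w⁻¹ j)).1 (by simpa using hij)
      simp only [Equiv.Perm.inv_def, Equiv.apply_symm_apply] at this
      have h2 : (i : ℕ) < j := hij
      rcases this with h3 | h3
      · omega
      · exact h3.2
    · intro i j hij hj
      have := (h (w⁻¹ i) (w⁻¹ j)).1 (by simpa using hij)
      simp only [Equiv.Perm.inv_def, Equiv.apply_symm_apply] at this
      have h2 : (i : ℕ) < j := hij
      rcases this with h3 | h3
      · omega
      · exact h3.2
  · rintro ⟨ha, hb⟩ p q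
    have key : ∀ p q, w p < w q → (m ≤ (w p : ℕ) ↔ m ≤ (w q : ℕ)) → p < q := by
      intro p q hpq hm
      by_cases h : m ≤ (w p : ℕ)
      · simpa using hb (w p) (w q) hpq h
      · simpa using ha (w p) (w q) hpq (by omega)
    constructor
    · intro hpq
      have h2 : (w p : ℕ) < w q := hpq
      by_cases h : (m ≤ (w p : ℕ) ↔ m ≤ (w q : ℕ))
      · exact Or.inr ⟨h, key p q hpq h⟩
      · left; omega
    · rintro (h | ⟨h, hpq⟩)
      · rw [Fin.lt_def]; omega
      · by_contra hn
        rcases (not_lt.1 hn).lt_or_eq with h3 | h3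
        · exact lt_asymm hpq (key q p h3 h.symm)
        · exact hpq.ne' (w.injective h3)

theorem srtMat_base {m : ℕ} (hm : m ≤ n) : Pm n m = (n.choose m : ℚ)⁻¹ • srtMat (baseF n m) := by
  ext σ τ
  simp only [Pm, Matrix.smul_apply, srtMat, smul_eq_mul]
  split_ifs with h
  · have : (baseF n m).filter (fun f => SrtBy f (σ⁻¹ * τ)) = {labF m (σ⁻¹ * τ)} := by
      ext f
      simp only [Finset.mem_filter, Finset.mem_singleton]
      constructor
      · intro hf; exact labF_unique hf.1 hf.2
      · rintro rfl; exact ⟨labF_mem hm _, (labF_srt m _).2 h⟩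
    rw [this]; simp
  · have : (baseF n m).filter (fun f => SrtBy f (σ⁻¹ * τ)) = ∅ := by
      rw [Finset.filter_eq_empty_iff]
      intro f hf hs
      have := labF_unique hf hs
      subst this
      exact h ((labF_srt m _).1 hs)
    rw [this]; simp

theorem powerset_map_aux {α β : Type} (g : α → β) (s : Multiset α) :
    (s.map g).powerset = s.powerset.map (Multiset.map g) := by
  induction s using Multiset.induction_on with
  | empty => simp
  | cons a s ih =>
    simp only [Multiset.map_cons, Multiset.powerset_cons, ih, Multiset.map_add, Multiset.map_map]
    congr 1
    apply Multiset.map_congr rfl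
    intro t _
    simp

theorem powerset_count {ι : Type} (C : Finset ι) (c : ι → ℕ) (m : ℕ) :
    (((C.val.map c).powerset).filter (fun t => t.sum = m)).card =
      (C.powerset.filter (fun T => ∑ i ∈ T, c i = m)).card := by
  rw [powerset_map_aux, Multiset.filter_map, Multiset.card_map]
  have : C.val.powerset = C.powerset.val.map Finset.val := by
    simp only [Finset.powerset, Multiset.map_pmap, Multiset.pmap_eq_map, Multiset.map_id']
  rw [this, Multiset.filter_map, Multiset.card_map]
  rfl

theorem count_inv {ι : Type} (σ : Equiv.Perm (Fin n)) (C : Finset ι) (blk : ι → Finset (Fin n))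
    (hne : ∀ i ∈ C, (blk i).Nonempty) (hcov : ∀ x, ∃ i ∈ C, x ∈ blk i)
    (hdis : ∀ i ∈ C, ∀ j ∈ C, ∀ x, x ∈ blk i → x ∈ blk j → i = j)
    (hsame : ∀ i ∈ C, ∀ x ∈ blk i, ∀ y, y ∈ blk i ↔ σ.SameCycle x y) (m : ℕ) :
    fixN (baseF n m) σ = (C.powerset.filter (fun T => ∑ i ∈ T, (blk i).card = m)).card := by
  have hfx : ∀ f : Fin n → Bool, IsFx σ f → ∀ x y, σ.SameCycle x y → f x = f y := by
    intro f hf x y hxy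
    obtain ⟨k, -, rfl⟩ := hxy.exists_pow_eq'
    clear hxy
    induction k with
    | zero => simp
    | succ k ih =>
      rw [ih, pow_succ', Equiv.Perm.mul_apply]
      exact (congrFun hf _).symm
  symm
  unfold fixN
  have hun : ∀ T ⊆ C, (T.biUnion blk).card = ∑ i ∈ T, (blk i).card := by
    intro T hT
    apply Finset.card_biUnion
    intro i hi j hj hij
    refine Finset.disjoint_left.2 ?_
    intro x hx hy
    exact hij (hdis i (hT hi) j (hT hj) x hx hy)
  refine Finset.card_bij' (fun T _ => fun x => decide (x ∉ T.biUnion blk))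
    (fun f _ => C.filter (fun i => ∀ x ∈ blk i, f x = false)) ?_ ?_ ?_ ?_
  · intro T hT
    simp only [Finset.mem_filter, Finset.mem_powerset] at hT
    simp only [Finset.mem_filter, baseF, Finset.mem_univ, true_and, decide_eq_false_iff_not,
      not_not]
    constructor
    · rw [Finset.filter_mem_eq_inter, Finset.univ_inter, hun T hT.1, hT.2]
    · unfold IsFx
      funext x
      have : σ x ∈ T.biUnion blk ↔ x ∈ T.biUnion blk := by
        simp only [Finset.mem_biUnion]
        refine exists_congr fun i => and_congr_right fun hi => ?_
        constructor
        · intro h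
          rw [hsame i (hT.1 hi) _ h]
          exact (Equiv.Perm.SameCycle.refl σ x).apply_left
        · intro h
          rw [hsame i (hT.1 hi) _ h]
          exact (Equiv.Perm.SameCycle.refl σ x).apply_right
      simp only [Function.comp, this]
  · intro f hf
    simp only [Finset.mem_filter, baseF, Finset.mem_univ, true_and] at hf
    simp only [Finset.mem_filter, Finset.mem_powerset]
    refine ⟨Finset.filter_subset _ _, ?_⟩
    rw [← hun _ (Finset.filter_subset _ _), ← hf.1]
    congr 1
    ext x
    simp only [Finset.mem_biUnion, Finset.mem_filter, Finset.mem_univ, true_and]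
    constructor
    · rintro ⟨i, hi, hx⟩; exact hi.2 x hx
    · intro hx
      obtain ⟨i, hi, hxi⟩ := hcov x
      refine ⟨i, ⟨hi, fun y hy => ?_⟩, hxi⟩
      rw [← hfx f hf.2 x y ((hsame i hi x hxi y).1 hy), hx]
  · intro T hT
    simp only [Finset.mem_filter, Finset.mem_powerset] at hT
    ext i
    simp only [Finset.mem_filter, decide_eq_false_iff_not, not_not, Finset.mem_biUnion]
    constructor
    · rintro ⟨hi, h⟩
      obtain ⟨x, hx⟩ := hne i hi
      obtain ⟨j, hj, hxj⟩ := h x hx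
      rwa [hdis i hi j (hT.1 hj) x hx hxj]
    · intro hi
      exact ⟨hT.1 hi, fun x hx => ⟨i, hi, hx⟩⟩
  · intro f hf
    simp only [Finset.mem_filter, baseF, Finset.mem_univ, true_and] at hf
    funext x
    obtain ⟨i, hi, hxi⟩ := hcov x
    by_cases hx : f x = false
    · rw [hx, decide_eq_false_iff_not, not_not, Finset.mem_biUnion]
      refine ⟨i, Finset.mem_filter.2 ⟨hi, fun y hy => ?_⟩, hxi⟩
      rw [← hfx f hf.2 x y ((hsame i hi x hxi y).1 hy), hx]
    · have hx' : f x = true := by simpa using hx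
      rw [hx', decide_eq_true_iff, Finset.mem_biUnion]
      rintro ⟨j, hj, hxj⟩
      exact hx ((Finset.mem_filter.1 hj).2 x hxj)

theorem fixN_base (m : ℕ) (σ : Equiv.Perm (Fin n)) : fixN (baseF n m) σ = bm n m σ := by
  let B : Finset (Fin n) := Finset.univ \ σ.support
  let C : Finset (Equiv.Perm (Fin n) ⊕ Fin n) := σ.cycleFactorsFinset.disjSum B
  let blk : Equiv.Perm (Fin n) ⊕ Fin n → Finset (Fin n) :=
    Sum.elim (fun c => c.support) (fun x => {x})
  have hfull : fullCycleType n σ = C.val.map (fun i => (blk i).card) := by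
    unfold fullCycleType
    simp only [C, Finset.disjSum, Multiset.disjSum, Multiset.map_add, Multiset.map_map, blk,
      Function.comp_def, Sum.elim_inl, Sum.elim_inr, Finset.card_singleton, Multiset.map_const']
    congr 1
    · congr 1
      have : B.card = n - σ.support.card := by
        rw [Finset.card_sdiff_of_subset (Finset.subset_univ _)]; simp
      exact this.symm
  unfold bm
  rw [hfull, powerset_count]
  have hinl : ∀ c, Sum.inl c ∈ C ↔ c ∈ σ.cycleFactorsFinset := by intro c; simp [C]
  have hinr : ∀ x, Sum.inr x ∈ C ↔ σ x = x := by intro c; simp [C, B]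
  have hsame : ∀ i ∈ C, ∀ x ∈ blk i, ∀ y, y ∈ blk i ↔ σ.SameCycle x y := by
    rintro (c | z) hi x hx y
    · rw [hinl] at hi
      simp only [blk, Sum.elim_inl] at hx ⊢
      have hc := Equiv.Perm.cycle_is_cycleOf hx hi
      have hxs : σ x ≠ x := by
        have := Equiv.Perm.mem_cycleFactorsFinset_support_le hi hx
        exact Equiv.Perm.mem_support.1 this
      rw [hc, Equiv.Perm.mem_support_cycleOf_iff' hxs]
    · rw [hinr] at hi
      simp only [blk, Sum.elim_inr, Finset.mem_singleton] at hx ⊢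
      subst hx
      constructor
      · rintro rfl; exact Equiv.Perm.SameCycle.refl _ _
      · intro h; exact (h.eq_of_left hi).symm
  have hbs : ∀ i ∈ C, ∀ x ∈ blk i, i = if σ x = x then Sum.inr x else Sum.inl (σ.cycleOf x) := by
    rintro (c | z) hi x hx
    · rw [hinl] at hi
      simp only [blk, Sum.elim_inl] at hx
      have hxs : σ x ≠ x := by
        have := Equiv.Perm.mem_cycleFactorsFinset_support_le hi hx
        exact Equiv.Perm.mem_support.1 this
      rw [if_neg hxs, Equiv.Perm.cycle_is_cycleOf hx hi]
    · rw [hinr] at hi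
      simp only [blk, Sum.elim_inr, Finset.mem_singleton] at hx
      subst hx
      rw [if_pos hi]
  apply count_inv σ C blk
  · rintro (c | z) hi
    · rw [hinl] at hi
      simp only [blk, Sum.elim_inl]
      rw [Finset.nonempty_iff_ne_empty, Ne, Equiv.Perm.support_eq_empty_iff]
      rintro rfl
      exact (Equiv.Perm.mem_cycleFactorsFinset_iff.1 hi).1.ne_one rfl
    · simp [blk]
  · intro x
    by_cases hx : σ x = x
    · exact ⟨Sum.inr x, (hinr x).2 hx, by simp [blk]⟩
    · refine ⟨Sum.inl (σ.cycleOf x), (hinl _).2 ?_, ?_⟩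
      · rw [Equiv.Perm.cycleOf_mem_cycleFactorsFinset_iff]
        exact Equiv.Perm.mem_support.2 hx
      · simp only [blk, Sum.elim_inl]
        rw [Equiv.Perm.mem_support_cycleOf_iff' hx]
  · intro i hi j hj x hxi hxj
    rw [hbs i hi x hxi, hbs j hj x hxj]
  · exact hsame

end helpers

/-- The characteristic polynomial of the top-`m`-to-random transition matrix is
`∏_{σ ∈ S_n} (X - b_m(σ)/C(n,m))`, where `b_m(σ)` is the number of sub-multisets
of the cycle-length multiset of `σ` summing to `m`. -/
theorem stmt8 (n m : ℕ) (hn : 2 ≤ n) (hm1 : 1 ≤ m) (hm2 : m ≤ n - 1) :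
    (Pm n m).charpoly =
      ∏ σ : Equiv.Perm (Fin n),
        (Polynomial.X - Polynomial.C ((bm n m σ : ℚ) / (n.choose m : ℚ))) := by
  apply charpoly_of_traces
  intro k
  rw [srtMat_base (by omega : m ≤ n), smul_pow, Matrix.trace_smul, trace_pow_srtMat (pinv_baseF m),
    smul_eq_mul, Finset.mul_sum]
  refine Finset.sum_congr rfl fun σ _ => ?_
  rw [fixN_base, div_pow, inv_pow, div_eq_inv_mul]
end

section
/- Let n ≥ 1 and a ≥ 1 be integers and let P_a be the a-handed riffle shuffle transition matrix on S_n. Then the function σ ↦ des(σ) − (n−1)/2 is a right eigenfunction of P_a with eigenvalue 1/a: for every σ ∈ S_n, Σ_{τ ∈ S_n} P_a(σ,τ)·(des(τ) − (n−1)/2) = (1/a)·(des(σ) − (n−1)/2). -/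
open Finset

/-- 0-indexed descent set of a deck arrangement: `i ∈ desSet n σ` iff the card at
position `i` is greater than the card at position `i+1` (positions `0, …, n-2`). -/
def desSet (n : ℕ) (σ : Equiv.Perm (Fin n)) : Finset ℕ :=
  (Finset.range (n - 1)).filter
    (fun i => ∃ h : i + 1 < n, σ ⟨i + 1, h⟩ < σ ⟨i, Nat.lt_of_succ_lt h⟩)

/-- `des σ` is the number of descents of `σ`. -/
def des (n : ℕ) (σ : Equiv.Perm (Fin n)) : ℕ := (desSet n σ).card

/-- Bayer–Diaconis `a`-handed riffle shuffle transition matrix on `S_n`: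
`Pa n a σ τ = C(n + a - 1 - des(τ⁻¹∘σ), n) / a^n`. -/
def Pa (n a : ℕ) : Matrix (Equiv.Perm (Fin n)) (Equiv.Perm (Fin n)) ℚ :=
  fun σ τ => ((n + a - 1 - des n (τ⁻¹ * σ)).choose n : ℚ) / (a : ℚ) ^ n

/-- The signed descent indicator. -/
def dsc {m : ℕ} (σ : Equiv.Perm (Fin (m + 1))) (i : Fin m) : ℚ :=
  if σ i.succ < σ i.castSucc then 1 / 2 else - (1 / 2)

lemma mem_desSet_iff {m : ℕ} (σ : Equiv.Perm (Fin (m + 1))) (i : Fin m) :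
    (i : ℕ) ∈ desSet (m + 1) σ ↔ σ i.succ < σ i.castSucc := by
  unfold desSet
  rw [Finset.mem_filter]
  constructor
  · rintro ⟨_, h, h'⟩
    exact h'
  · intro h
    exact ⟨by simp, by simp, h⟩

lemma desSet_subset {m : ℕ} (σ : Equiv.Perm (Fin (m + 1))) :
    desSet (m + 1) σ ⊆ Finset.range m := by
  unfold desSet
  exact Finset.filter_subset _ _

lemma des_eq_sum {m : ℕ} (σ : Equiv.Perm (Fin (m + 1))) :
    (des (m + 1) σ : ℚ) - (m : ℚ) / 2 = ∑ i, dsc σ i := by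
  have h1 : (des (m + 1) σ : ℚ) = ∑ i : Fin m, if σ i.succ < σ i.castSucc then (1 : ℚ) else 0 := by
    unfold des
    rw [← Finset.inter_eq_right.mpr (desSet_subset σ), ← Finset.filter_mem_eq_inter,
      Finset.card_filter]
    push_cast
    rw [Finset.sum_range]
    simp only [mem_desSet_iff]
  have h2 : (m : ℚ) / 2 = ∑ i : Fin m, (1 / 2 : ℚ) := by simp; ring
  rw [h1, h2, ← Finset.sum_sub_distrib]
  apply Finset.sum_congr rfl
  intro i _
  unfold dsc
  split_ifs <;> norm_num

/-- number of non-descents before `i` -/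
def ndes (S : Finset ℕ) (i : ℕ) : ℕ := ((Finset.range i).filter (fun k => k ∉ S)).card

lemma ndes_succ (S : Finset ℕ) (i : ℕ) :
    ndes S (i + 1) = ndes S i + if i ∈ S then 0 else 1 := by
  unfold ndes
  rw [Finset.range_add_one, Finset.filter_insert]
  split_ifs with h h2 <;> simp_all

lemma ndes_le (S : Finset ℕ) (i : ℕ) : ndes S i ≤ i := by
  unfold ndes
  exact (Finset.card_filter_le _ _).trans (by simp)

lemma ndes_mono (S : Finset ℕ) : Monotone (ndes S) := by
  apply monotone_nat_of_le_succ
  intro i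
  rw [ndes_succ]; omega

lemma ndes_last {m : ℕ} (σ : Equiv.Perm (Fin (m + 1))) :
    ndes (desSet (m + 1) σ) m + des (m + 1) σ = m := by
  have h := Finset.card_filter_add_card_filter_not (s := Finset.range m)
    (fun k => k ∈ desSet (m + 1) σ)
  rw [Finset.filter_mem_eq_inter, Finset.inter_eq_right.mpr (desSet_subset σ)] at h
  unfold ndes des
  simp only [Finset.card_range] at h
  omega

lemma sort_iff_step {m a : ℕ} (ρ : Equiv.Perm (Fin (m + 1))) (w : Fin (m + 1) → Fin a) :
    Tuple.sort w = ρ ↔ ∀ i : Fin m,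
      ((w (ρ i.castSucc) : ℕ) < w (ρ i.succ) ∨
        (w (ρ i.castSucc) : ℕ) = w (ρ i.succ) ∧ (i : ℕ) ∉ desSet (m + 1) ρ) := by
  rw [eq_comm, Tuple.eq_sort_iff', Fin.strictMono_iff_lt_succ]
  apply forall_congr'
  intro i
  rw [mem_desSet_iff]
  change toLex (w (ρ i.castSucc), ρ i.castSucc) < toLex (w (ρ i.succ), ρ i.succ) ↔ _
  rw [Prod.Lex.toLex_lt_toLex]
  have hne : ρ i.castSucc ≠ ρ i.succ := fun h => by
    have := ρ.injective h
    simp [Fin.ext_iff] at this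
  simp only [not_lt, Fin.lt_def, Fin.ext_iff, Fin.le_def, ne_eq] at *
  omega

lemma card_sort {m a : ℕ} (ρ : Equiv.Perm (Fin (m + 1))) :
    (Finset.univ.filter (fun w : Fin (m + 1) → Fin a => Tuple.sort w = ρ)).card
      = (m + 1 + a - 1 - des (m + 1) ρ).choose (m + 1) := by
  set S := desSet (m + 1) ρ with hS
  have hlast := ndes_last ρ
  rw [← hS] at hlast
  set N := m + 1 + a - 1 - des (m + 1) ρ with hN
  have hNa : N = a + ndes S m := by omega
  have hcard : Fintype.card (Fin (m + 1) ↪o Fin N) = N.choose (m + 1) := by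
    rw [Fintype.card_eq_nat_card, Nat.card_congr Set.powersetCard.ofFinEmbEquiv]
    rw [Set.powersetCard.card, Nat.card_fin]
  rw [← hcard, ← Finset.card_univ]
  refine Finset.card_bij (fun w hw => OrderEmbedding.ofStrictMono
    (fun i : Fin (m + 1) => (⟨w (ρ i) + ndes S i, by
      have := ndes_mono S (Nat.lt_succ_iff.mp i.2)
      have := (w (ρ i)).2
      omega⟩ : Fin N)) ?_) ?_ ?_ ?_
  · rw [Finset.mem_filter] at hw
    have h := (sort_iff_step ρ w).1 hw.2
    rw [Fin.strictMono_iff_lt_succ]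
    intro i
    have := h i
    have h3 := ndes_succ S i
    simp only [Fin.lt_def, Fin.val_succ, Fin.val_castSucc]
    rw [h3]
    split_ifs with hi
    · have := this.resolve_right (fun h => h.2 hi)
      omega
    · omega
  · intros; simp
  · intro w hw w' hw' h
    funext x
    have := congrArg (fun f : Fin (m + 1) ↪o Fin N => (f (ρ.symm x) : ℕ)) h
    simp at this
    exact Fin.ext this
  · intro f _
    have hmono := f.strictMono
    rw [Fin.strictMono_iff_lt_succ] at hmono
    have hge : ∀ i : Fin (m + 1), (i : ℕ) ≤ f i := by
      intro i
      induction i using Fin.induction with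
      | zero => simp
      | succ i ih =>
        have := hmono i
        simp only [Fin.lt_def, Fin.val_succ, Fin.val_castSucc] at *
        omega
    have hge2 : ∀ i : Fin (m + 1), ndes S i ≤ f i := fun i => (ndes_le S i).trans (hge i)
    have hm2 : Monotone (fun i : Fin (m + 1) => (f i : ℕ) - ndes S i) := by
      rw [Fin.monotone_iff_le_succ]
      intro i
      have := hmono i
      have h3 := ndes_succ S i
      simp only [Fin.lt_def, Fin.val_succ, Fin.val_castSucc] at *
      split_ifs at h3 <;> omega
    have hlt : ∀ i : Fin (m + 1), (f i : ℕ) - ndes S i < a := by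
      intro i
      have h1 := hm2 (Fin.le_last i)
      have h2 := (f (Fin.last m)).2
      have h4 := hge2 (Fin.last m)
      simp only [Fin.val_last] at h1 h4
      omega
    refine ⟨fun x => ⟨(f (ρ.symm x) : ℕ) - ndes S (ρ.symm x), hlt _⟩, ?_, ?_⟩
    · rw [Finset.mem_filter]
      refine ⟨Finset.mem_univ _, ?_⟩
      rw [sort_iff_step]
      intro i
      have := hmono i
      have h3 := ndes_succ S i
      have h4 := hge2 i.castSucc
      have h5 := hge2 i.succ
      simp only [Fin.lt_def, Fin.val_succ, Fin.val_castSucc, Equiv.symm_apply_apply] at *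
      rw [← hS]
      by_cases hi : (i : ℕ) ∈ S
      · simp only [hi, if_true] at h3
        left; omega
      · simp only [hi, if_false] at h3
        simp only [hi, not_false_eq_true, and_true]
        omega
    · ext i
      have := hge2 i
      simp
      omega

lemma rank_lt_iff {n a : ℕ} (w : Fin n → Fin a) (j k : Fin n) :
    (Tuple.sort w)⁻¹ k < (Tuple.sort w)⁻¹ j ↔ w k < w j ∨ w k = w j ∧ k < j := by
  have h := (Tuple.eq_sort_iff' (f := w) (σ := Tuple.sort w)).1 rfl
  rw [← h.lt_iff_lt]
  change toLex (w (Tuple.sort w ((Tuple.sort w)⁻¹ k)), Tuple.sort w ((Tuple.sort w)⁻¹ k)) <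
    toLex (w (Tuple.sort w ((Tuple.sort w)⁻¹ j)), Tuple.sort w ((Tuple.sort w)⁻¹ j)) ↔ _
  simp [Prod.Lex.toLex_lt_toLex]

lemma rank_eq {n a : ℕ} (w : Fin n → Fin a) (j : Fin n) :
    (((Tuple.sort w)⁻¹ j : Fin n) : ℕ) =
      ∑ k, if w k < w j ∨ w k = w j ∧ k < j then 1 else 0 := by
  simp only [← rank_lt_iff]
  rw [Equiv.sum_comp (Tuple.sort w)⁻¹ (fun k => if k < (Tuple.sort w)⁻¹ j then 1 else 0)]
  rw [← Finset.card_filter]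
  simp [Finset.filter_gt_eq_Iio]

lemma rank_insert {m a : ℕ} (w : Fin m → Fin a) (j : Fin m) :
    (Tuple.sort (w ∘ j.predAbove))⁻¹ j.castSucc = ((Tuple.sort w)⁻¹ j).castSucc ∧
    (Tuple.sort (w ∘ j.predAbove))⁻¹ j.succ = ((Tuple.sort w)⁻¹ j).succ := by
  have key : ∀ k : Fin m, (j.castSucc.succAbove k < j.castSucc ↔ k < j) ∧
      (j.castSucc.succAbove k < j.succ ↔ k < j) := by
    intro k
    unfold Fin.succAbove
    simp only [Fin.lt_def, Fin.val_castSucc]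
    split_ifs <;> simp <;> omega
  constructor
  · ext
    rw [rank_eq, Fin.sum_univ_succAbove _ j.castSucc, Fin.val_castSucc, rank_eq]
    simp [(key _).1]
  · ext
    rw [rank_eq, Fin.sum_univ_succAbove _ j.castSucc, Fin.val_succ, rank_eq]
    simp [(key _).2]
    omega

lemma sort_swap {m a : ℕ} (w : Fin (m + 1) → Fin a) (j : Fin m)
    (h : w j.castSucc ≠ w j.succ) :
    Tuple.sort (w ∘ Equiv.swap j.castSucc j.succ) =
      Equiv.swap j.castSucc j.succ * Tuple.sort w := by
  symm
  rw [Tuple.eq_sort_iff]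
  obtain ⟨h1, h2⟩ := (Tuple.eq_sort_iff (f := w) (σ := Tuple.sort w)).1 rfl
  constructor
  · intro x y hxy
    simpa using h1 hxy
  · intro x y hxy he
    simp only [Function.comp, Equiv.Perm.mul_apply, Equiv.swap_apply_self] at he ⊢
    have h3 := h2 x y hxy he
    generalize Tuple.sort w x = p at *
    generalize Tuple.sort w y = q at *
    simp only [Equiv.swap_apply_def]
    by_cases hp : p = j.castSucc
    · by_cases hq : q = j.succ
      · subst hp hq; exact absurd he h
      · simp only [Fin.lt_def, Fin.ext_iff, Fin.val_succ, Fin.val_castSucc] at *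
        split_ifs <;> simp <;> omega
    · simp only [Fin.lt_def, Fin.ext_iff, Fin.val_succ, Fin.val_castSucc] at *
      split_ifs <;> simp <;> omega

lemma sum_ne {m a : ℕ} (σ : Equiv.Perm (Fin (m + 1))) (j : Fin m) :
    ∑ w ∈ Finset.univ.filter (fun w : Fin (m + 1) → Fin a => ¬ w j.castSucc = w j.succ),
      dsc (σ * (Tuple.sort w)⁻¹) j = 0 := by
  have hadd : ∀ w : Fin (m + 1) → Fin a, ¬ w j.castSucc = w j.succ →
      dsc (σ * (Tuple.sort w)⁻¹) j +
        dsc (σ * (Tuple.sort (w ∘ Equiv.swap j.castSucc j.succ))⁻¹) j = 0 := by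
    intro w hw
    rw [sort_swap w j hw, mul_inv_rev, Equiv.swap_inv, ← mul_assoc]
    have hne : (σ * (Tuple.sort w)⁻¹) j.castSucc ≠ (σ * (Tuple.sort w)⁻¹) j.succ := fun h => by
      have := (σ * (Tuple.sort w)⁻¹).injective h
      simp [Fin.ext_iff] at this
    generalize σ * (Tuple.sort w)⁻¹ = π at *
    unfold dsc
    simp only [Equiv.Perm.mul_apply, Equiv.swap_apply_left, Equiv.swap_apply_right]
    rcases lt_or_gt_of_ne hne with h | h
    · simp [h, h.not_gt]
    · simp [h, h.not_gt]
  refine Finset.sum_involution (fun w _ => w ∘ Equiv.swap j.castSucc j.succ) ?_ ?_ ?_ ?_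
  · intro w hw
    exact hadd w (Finset.mem_filter.1 hw).2
  · intro w hw _ h
    have := congrFun h j.succ
    simp at this
    exact (Finset.mem_filter.1 hw).2 this
  · intro w hw
    have := (Finset.mem_filter.1 hw).2
    simp only [Finset.mem_filter, Finset.mem_univ, true_and, Function.comp,
      Equiv.swap_apply_left, Equiv.swap_apply_right]
    exact fun h => this h.symm
  · intro w hw
    funext x
    simp

lemma sum_eq {m a : ℕ} (σ : Equiv.Perm (Fin (m + 1))) (j : Fin m) :
    ∑ w ∈ Finset.univ.filter (fun w : Fin (m + 1) → Fin a => w j.castSucc = w j.succ),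
      dsc (σ * (Tuple.sort w)⁻¹) j =
    ∑ w : Fin m → Fin a, dsc σ ((Tuple.sort w)⁻¹ j) := by
  symm
  refine Finset.sum_bij' (fun w _ => w ∘ j.predAbove) (fun w _ => w ∘ j.castSucc.succAbove)
    ?_ ?_ ?_ ?_ ?_
  · intro w _
    simp
  · intros; simp
  · intro w _
    funext x
    simp
  · intro w hw
    have := (Finset.mem_filter.1 hw).2
    funext x
    simp only [Function.comp]
    by_cases hx : x = j.castSucc
    · subst hx
      simp [this]
    · rw [Fin.succAbove_predAbove hx]
  · intro w _
    unfold dsc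
    simp only [Equiv.Perm.mul_apply, (rank_insert w j).1, (rank_insert w j).2]

lemma word_sum {m a : ℕ} (σ : Equiv.Perm (Fin (m + 1))) :
    ∑ w : Fin (m + 1) → Fin a, ((des (m + 1) (σ * (Tuple.sort w)⁻¹) : ℚ) - (m : ℚ) / 2) =
      (a : ℚ) ^ m * ((des (m + 1) σ : ℚ) - (m : ℚ) / 2) := by
  simp only [des_eq_sum]
  rw [Finset.sum_comm]
  have : ∀ j : Fin m, ∑ w : Fin (m + 1) → Fin a, dsc (σ * (Tuple.sort w)⁻¹) j =
      ∑ w : Fin m → Fin a, dsc σ ((Tuple.sort w)⁻¹ j) := by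
    intro j
    rw [← Finset.sum_filter_add_sum_filter_not _
      (fun w : Fin (m + 1) → Fin a => w j.castSucc = w j.succ), sum_ne, sum_eq, add_zero]
  simp only [this]
  rw [Finset.sum_comm]
  simp only [Equiv.sum_comp _ (fun i => dsc σ i)]
  simp

/-- `σ ↦ des(σ) - (n-1)/2` is a right eigenfunction of the `a`-handed riffle
shuffle transition matrix with eigenvalue `1/a`. -/
theorem stmt17 (n a : ℕ) (hn : 1 ≤ n) (ha : 1 ≤ a) (σ : Equiv.Perm (Fin n)) :
    ∑ τ : Equiv.Perm (Fin n), Pa n a σ τ * ((des n τ : ℚ) - ((n : ℚ) - 1) / 2) =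
      (1 / (a : ℚ)) * ((des n σ : ℚ) - ((n : ℚ) - 1) / 2) := by
  obtain ⟨m, rfl⟩ : ∃ m, n = m + 1 := ⟨n - 1, by omega⟩
  have hm : ((m + 1 : ℕ) : ℚ) - 1 = m := by push_cast; ring
  rw [hm]
  have ha0 : (a : ℚ) ≠ 0 := by positivity
  have hw := word_sum (a := a) σ
  rw [← Finset.sum_fiberwise (s := Finset.univ)
    (g := fun w : Fin (m + 1) → Fin a => σ * (Tuple.sort w)⁻¹)] at hw
  have h1 : ∀ τ : Equiv.Perm (Fin (m + 1)),
      Pa (m + 1) a σ τ * ((des (m + 1) τ : ℚ) - (m : ℚ) / 2) =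
      (∑ w ∈ Finset.univ.filter (fun w : Fin (m + 1) → Fin a => σ * (Tuple.sort w)⁻¹ = τ),
        ((des (m + 1) (σ * (Tuple.sort w)⁻¹) : ℚ) - (m : ℚ) / 2)) / (a : ℚ) ^ (m + 1) := by
    intro τ
    have h2 : ∑ w ∈ Finset.univ.filter (fun w : Fin (m + 1) → Fin a => σ * (Tuple.sort w)⁻¹ = τ),
        ((des (m + 1) (σ * (Tuple.sort w)⁻¹) : ℚ) - (m : ℚ) / 2) =
        ∑ w ∈ Finset.univ.filter (fun w : Fin (m + 1) → Fin a => σ * (Tuple.sort w)⁻¹ = τ),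
        ((des (m + 1) τ : ℚ) - (m : ℚ) / 2) := by
      apply Finset.sum_congr rfl
      intro w hw
      rw [(Finset.mem_filter.1 hw).2]
    have h3 : Finset.univ.filter (fun w : Fin (m + 1) → Fin a => σ * (Tuple.sort w)⁻¹ = τ) =
        Finset.univ.filter (fun w : Fin (m + 1) → Fin a => Tuple.sort w = τ⁻¹ * σ) := by
      apply Finset.filter_congr
      intro w _
      rw [mul_inv_eq_iff_eq_mul, eq_inv_mul_iff_mul_eq, eq_comm]
    rw [h2, h3, Finset.sum_const, card_sort, nsmul_eq_mul]
    unfold Pa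
    ring
  rw [Finset.sum_congr rfl (fun τ _ => h1 τ), ← Finset.sum_div, hw]
  field_simp
  ring
end
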